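/- Let G be a finite simple graph on n ≥ 4 vertices and K a field. If e^u − e^v (with u ≠ v) is a primitive binomial of the toric ideal I_G, then its degree is at most n − 2; that is, the total degree of the monomial e^u (which equals the total degree of e^v) satisfies |u| = |v| ≤ n − 2. -/

import Mathlib

open MvPolynomial

/-- The image of an edge `{i, j}` under the monomial map: the monomial `t_i * t_j`. -/
noncomputable def edgeMonomial (V K : Type) [CommRing K] : Sym2 V → MvPolynomial V K :=
  Sym2.lift ⟨fun i j => X i * X j, fun i j => mul_comm _ _⟩

/-- The toric ideal `I_G` of a graph `G`: the kernel of the `K`-algebra homomorphism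
from the polynomial ring with one variable per edge of `G` to the polynomial ring with
one variable per vertex, sending the variable of an edge `e = {v_i, v_j}` to `t_i t_j`. -/
noncomputable def toricIdeal (V K : Type) [Field K] (G : SimpleGraph V) :
    Ideal (MvPolynomial G.edgeSet K) :=
  RingHom.ker (aeval (fun e : G.edgeSet => edgeMonomial V K (e : Sym2 V)) :
    MvPolynomial G.edgeSet K →ₐ[K] MvPolynomial V K)

/-- Position `p < L` is the only position below `L` at which the sequence takes its value. -/
def IsLonePosition {V : Type} (w : ℕ → V) (L p : ℕ) : Prop :=
  ∀ q < L, w q = w p → q = p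

/-- Two equal entries of a non-crossing sequence enclose at least two lone positions. -/
lemma exists_lonePositions_between {V : Type} {w : ℕ → V} {L : ℕ}
    (hodd : ∀ i j, i < j → j < L → w i = w j → (i + j) % 2 = 1)
    (hadj : ∀ i, i + 1 < L → w i ≠ w (i + 1))
    (hcross : ∀ i k j l, i < k → k < j → j < l → l < L → w i = w j → w k ≠ w l)
    {i j : ℕ} (hij : i < j) (hj : j < L) (hw : w i = w j) :
    ∃ p q, i < p ∧ p < q ∧ q < j ∧ IsLonePosition w L p ∧ IsLonePosition w L q := by
  induction hd : j - i using Nat.strong_induction_on generalizing i j with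
  | _ d ih =>
  have hpar := hodd i j hij hj hw
  have hne : j ≠ i + 1 := by
    rintro rfl
    exact hadj i hj hw
  have inner : ∀ p, i < p → p < j → ¬ IsLonePosition w L p →
      ∃ p q, i < p ∧ p < q ∧ q < j ∧ IsLonePosition w L p ∧ IsLonePosition w L q := by
    intro p hip hpj hp
    simp only [IsLonePosition, not_forall] at hp
    obtain ⟨q, hqL, hqp, hne⟩ := hp
    have hqi : i < q := by
      by_contra h
      rcases Nat.lt_or_ge q i with h' | h'
      · exact hcross q i p j h' hip hpj hj hqp hw
      · obtain rfl : q = i := by omega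
        have := hodd q p hip (by omega) hqp
        have := hodd p j hpj hj (hqp.symm.trans hw)
        omega
    have hqj : q < j := by
      by_contra h
      rcases Nat.lt_or_ge j q with h' | h'
      · exact hcross i p j q hip hpj h' hqL hw hqp.symm
      · obtain rfl : q = j := by omega
        have := hodd i p hip (by omega) (hw.trans hqp)
        have := hodd p q hpj hj hqp.symm
        omega
    rcases Nat.lt_or_gt_of_ne hne with h | h
    · obtain ⟨a, b, h1, h2, h3, h4⟩ := ih (p - q) (by omega) h (by omega) hqp rfl
      exact ⟨a, b, by omega, h2, by omega, h4⟩
    · obtain ⟨a, b, h1, h2, h3, h4⟩ := ih (q - p) (by omega) h hqL hqp.symm rfl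
      exact ⟨a, b, by omega, h2, by omega, h4⟩
  by_cases h1 : IsLonePosition w L (i + 1)
  · by_cases h2 : IsLonePosition w L (i + 2)
    · exact ⟨i + 1, i + 2, by omega, by omega, by omega, h1, h2⟩
    · exact inner _ (by omega) (by omega) h2
  · exact inner _ (by omega) (by omega) h1

open Classical in
/-- A cyclic non-crossing sequence of even length at least four has at least four lone positions. -/
lemma four_le_card_lonePositions {V : Type} {w : ℕ → V} {L : ℕ}
    (hL : 4 ≤ L) (heven : L % 2 = 0)
    (hodd : ∀ i j, i < j → j < L → w i = w j → (i + j) % 2 = 1)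
    (hadj : ∀ i, i + 1 < L → w i ≠ w (i + 1))
    (hends : w 0 ≠ w (L - 1))
    (hcross : ∀ i k j l, i < k → k < j → j < l → l < L → w i = w j → w k ≠ w l) :
    4 ≤ ((Finset.range L).filter (IsLonePosition w L)).card := by
  have key : ∀ a b c d, a ≠ b → a ≠ c → a ≠ d → b ≠ c → b ≠ d → c ≠ d →
      a < L → b < L → c < L → d < L → IsLonePosition w L a → IsLonePosition w L b →
      IsLonePosition w L c → IsLonePosition w L d →
      4 ≤ ((Finset.range L).filter (IsLonePosition w L)).card := by
    intro a b c d hab hac had hbc hbd hcd ha hb hc hd la lb lc ld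
    have h : ({a, b, c, d} : Finset ℕ) ⊆ (Finset.range L).filter (IsLonePosition w L) := by
      intro x hx
      simp only [Finset.mem_insert, Finset.mem_singleton] at hx
      rcases hx with rfl | rfl | rfl | rfl <;> simp [*]
    calc 4 = ({a, b, c, d} : Finset ℕ).card := by
          simp [Finset.card_insert_of_notMem, *]
      _ ≤ _ := Finset.card_le_card h
  by_cases hpair : ∃ d, ∃ i j, i < j ∧ j < L ∧ w i = w j ∧ j - i = d
  swap
  · have lone : ∀ p < L, IsLonePosition w L p := by
      intro p hp q hq hqp
      by_contra hne
      rcases Nat.lt_or_gt_of_ne hne with h | h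
      · exact hpair ⟨_, q, p, h, hp, hqp, rfl⟩
      · exact hpair ⟨_, p, q, h, hq, hqp.symm, rfl⟩
    exact key 0 1 2 3 (by omega) (by omega) (by omega) (by omega) (by omega) (by omega)
      (by omega) (by omega) (by omega) (by omega) (lone _ (by omega)) (lone _ (by omega))
      (lone _ (by omega)) (lone _ (by omega))
  obtain ⟨i, j, hij, hj, hw, hmax⟩ : ∃ i j, i < j ∧ j < L ∧ w i = w j ∧
      ∀ i' j', i' < j' → j' < L → w i' = w j' → j' - i' ≤ j - i := by
    obtain ⟨d, hd⟩ := hpair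
    have hs := Nat.findGreatest_spec (P := fun d => ∃ i j, i < j ∧ j < L ∧ w i = w j ∧ j - i = d)
      (n := L) (m := d) (by obtain ⟨i, j, h⟩ := hd; omega) hd
    obtain ⟨i, j, h1, h2, h3, h4⟩ := hs
    refine ⟨i, j, h1, h2, h3, fun i' j' a b c => ?_⟩
    rw [h4]
    exact Nat.le_findGreatest (by omega) ⟨i', j', a, b, c, rfl⟩
  obtain ⟨p, q, hip, hpq, hqj, lp, lq⟩ := exists_lonePositions_between hodd hadj hcross hij hj hw
  by_cases hout : ∀ r < L, r < i ∨ j < r → IsLonePosition w L r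
  · have hpar := hodd i j hij hj hw
    have hfull : ¬ (i = 0 ∧ j = L - 1) := by
      rintro ⟨rfl, rfl⟩
      exact hends hw
    have : ∃ r s, r < s ∧ s < L ∧ (r < i ∨ j < r) ∧ (s < i ∨ j < s) := by
      rcases Nat.lt_or_ge 1 i with h | h
      · exact ⟨0, 1, by omega, by omega, by omega, by omega⟩
      · rcases Nat.lt_or_ge 0 i with h' | h'
        · exact ⟨0, L - 1, by omega, by omega, by omega, by omega⟩
        · exact ⟨L - 2, L - 1, by omega, by omega, by omega, by omega⟩
    obtain ⟨r, s, hrs, hs, hr', hs'⟩ := this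
    exact key p q r s (by omega) (by omega) (by omega) (by omega) (by omega) (by omega)
      (by omega) (by omega) (by omega) (by omega) lp lq
      (hout _ (by omega) hr') (hout _ (by omega) hs')
  · simp only [not_forall] at hout
    obtain ⟨r, hrL, hr, hlone⟩ := hout
    simp only [IsLonePosition, not_forall] at hlone
    obtain ⟨s, hsL, hsr, hne⟩ := hlone
    have side : ∃ a b, a < b ∧ b < L ∧ w a = w b ∧ (a < i ∨ j < a) := by
      rcases Nat.lt_or_gt_of_ne hne with h | h
      · by_cases hs : s < i ∨ j < s
        · exact ⟨s, r, h, hrL, hsr, hs⟩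
        · exfalso
          rcases (show s = i ∨ s = j ∨ (i < s ∧ s < j) by omega) with rfl | rfl | ⟨h1, h2⟩
          · have := hmax s r h hrL hsr
            omega
          · have := hmax i r (by omega) hrL (hw.trans hsr)
            omega
          · exact hcross i s j r h1 h2 (by omega) hrL hw hsr
      · by_cases hs : r < i ∨ j < r
        · exact ⟨r, s, h, hsL, hsr.symm, hs⟩
        · omega
    obtain ⟨a, b, hab, hb, hwab, ha⟩ := side
    have hbi : b < i ∨ j < a := by
      by_contra hcon
      rcases (show b = i ∨ b = j ∨ j < b ∨ (i < b ∧ b < j) by omega) with rfl | rfl | h | ⟨h1, h2⟩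
      · have := hmax a j (by omega) hj (hwab.trans hw)
        omega
      · have := hmax a b hab hb hwab
        omega
      · have := hmax a b hab hb hwab
        omega
      · exact hcross a i b j (by omega) h1 h2 hj hwab hw
    obtain ⟨r, s, h1, h2, h3, lr, ls⟩ := exists_lonePositions_between hodd hadj hcross hab hb hwab
    exact key p q r s (by omega) (by omega) (by omega) (by omega) (by omega) (by omega)
      (by omega) (by omega) (by omega) (by omega) lp lq lr ls

/-- A cyclic non-crossing sequence of even length `L ≥ 4` in a set with `n` elements satisfies
`L + 4 ≤ 2 n`. -/
lemma length_add_four_le_two_mul_card {V : Type} [Fintype V] {w : ℕ → V} {L : ℕ}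
    (hL : 4 ≤ L) (heven : L % 2 = 0)
    (hodd : ∀ i j, i < j → j < L → w i = w j → (i + j) % 2 = 1)
    (hadj : ∀ i, i + 1 < L → w i ≠ w (i + 1))
    (hends : w 0 ≠ w (L - 1))
    (hcross : ∀ i k j l, i < k → k < j → j < l → l < L → w i = w j → w k ≠ w l) :
    L + 4 ≤ 2 * Fintype.card V := by
  classical
  have h4 := four_le_card_lonePositions hL heven hodd hadj hends hcross
  set U := (Finset.range L).filter (IsLonePosition w L) with hU
  have e1 : L = ∑ x : V, ((Finset.range L).filter (fun i => w i = x)).card := by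
    have := Finset.card_eq_sum_card_fiberwise (s := Finset.range L) (t := Finset.univ) (f := w)
      (fun _ _ => Finset.mem_coe.2 (Finset.mem_univ _))
    rwa [Finset.card_range] at this
  have e2 : U.card = ∑ x : V, (U.filter (fun i => w i = x)).card :=
    Finset.card_eq_sum_card_fiberwise (fun _ _ => Finset.mem_coe.2 (Finset.mem_univ _))
  have hx : ∀ x : V, ((Finset.range L).filter (fun i => w i = x)).card +
      (U.filter (fun i => w i = x)).card ≤ 2 := by
    intro x
    have hsub : U.filter (fun i => w i = x) ⊆ (Finset.range L).filter (fun i => w i = x) :=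
      Finset.filter_subset_filter _ (Finset.filter_subset _ _)
    rcases (U.filter (fun i => w i = x)).eq_empty_or_nonempty with h | ⟨p, hp⟩
    · rw [h, Finset.card_empty, add_zero]
      by_contra! hlt
      obtain ⟨a, ha, b, hb, c, hc, hab, hac, hbc⟩ := Finset.two_lt_card.1 hlt
      simp only [Finset.mem_filter, Finset.mem_range] at ha hb hc
      have par : ∀ i j, i ≠ j → i < L → j < L → w i = w j → (i + j) % 2 = 1 := by
        intro i j hne hi hj hw
        rcases Nat.lt_or_gt_of_ne hne with h | h
        · exact hodd i j h hj hw
        · rw [add_comm]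
          exact hodd j i h hi hw.symm
      have := par a b hab ha.1 hb.1 (ha.2.trans hb.2.symm)
      have := par a c hac ha.1 hc.1 (ha.2.trans hc.2.symm)
      have := par b c hbc hb.1 hc.1 (hb.2.trans hc.2.symm)
      omega
    · simp only [hU, Finset.mem_filter, Finset.mem_range] at hp
      have h1 : (Finset.range L).filter (fun i => w i = x) ⊆ {p} := by
        intro q hq
        simp only [Finset.mem_filter, Finset.mem_range] at hq
        rw [Finset.mem_singleton]
        exact hp.1.2 q hq.1 (hq.2.trans hp.2.symm)
      have h2 := Finset.card_le_card h1
      have h3 := Finset.card_le_card hsub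
      rw [Finset.card_singleton] at h2
      omega
  have hsum := Finset.sum_le_sum (fun x (_ : x ∈ Finset.univ) => hx x)
  rw [Finset.sum_add_distrib, ← e1, ← e2, Finset.sum_const, Finset.card_univ, smul_eq_mul] at hsum
  omega

/-- The number of positions `i ∈ S` of parity `b` at which the sequence `w` traverses `e`. -/
def edgeUse {V : Type} [DecidableEq V] (w : ℕ → V) (S : Finset ℕ) (b : Bool) (e : Sym2 V) : ℕ :=
  (S.filter (fun i => i.bodd = b ∧ s(w i, w (i + 1)) = e)).card

/-- The degree of `x` in the multigraph formed by the edges of colour `b`. -/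
def colourDegree {V : Type} [Fintype V] [DecidableEq V] (c : Bool → Sym2 V → ℕ) (b : Bool)
    (x : V) : ℕ :=
  ∑ e with x ∈ e, c b e

section

variable {V : Type} [DecidableEq V]

lemma edgeUse_mono (w : ℕ → V) {S T : Finset ℕ} (h : S ⊆ T) (b : Bool) (e : Sym2 V) :
    edgeUse w S b e ≤ edgeUse w T b e :=
  Finset.card_le_card (Finset.filter_subset_filter _ h)

lemma edgeUse_ne_zero (w : ℕ → V) {S : Finset ℕ} {i : ℕ} (h : i ∈ S) :
    edgeUse w S i.bodd s(w i, w (i + 1)) ≠ 0 :=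
  Finset.card_ne_zero.2 ⟨i, by simp [h]⟩

lemma sum_alternating_Ico (f : ℕ → ℤ) {a b : ℕ} (h : a ≤ b) :
    ∑ i ∈ Finset.Ico a b, (-1) ^ i * (f i + f (i + 1)) = (-1) ^ a * f a - (-1) ^ b * f b := by
  induction b, h using Nat.le_induction with
  | base => simp
  | succ n hn ih =>
    rw [Finset.sum_Ico_succ_top hn, ih]
    ring

variable [Fintype V]

lemma sum_edgeUse (w : ℕ → V) (S : Finset ℕ) :
    ∑ e, edgeUse w S false e + ∑ e, edgeUse w S true e = S.card := by
  have h : ∀ b, ∑ e, edgeUse w S b e = (S.filter (fun i => i.bodd = b)).card := by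
    intro b
    rw [Finset.card_eq_sum_card_fiberwise (f := fun i => s(w i, w (i + 1)))
      (t := Finset.univ) (fun _ _ => Finset.mem_coe.2 (Finset.mem_univ _))]
    simp [edgeUse, Finset.filter_filter]
  rw [h, h, ← Finset.card_filter_add_card_filter_not (s := S) (fun i => i.bodd = false)]
  simp

lemma colourDegree_edgeUse (w : ℕ → V) (S : Finset ℕ) (b : Bool) (x : V) :
    colourDegree (edgeUse w S) b x =
      (S.filter (fun i => i.bodd = b ∧ x ∈ s(w i, w (i + 1)))).card := by
  rw [Finset.card_eq_sum_card_fiberwise (f := fun i => s(w i, w (i + 1)))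
      (t := Finset.univ.filter (x ∈ ·)) (fun i hi => by simp_all)]
  refine Finset.sum_congr rfl fun e he => ?_
  rw [Finset.mem_filter] at he
  rw [edgeUse, Finset.filter_filter]
  congr 1
  ext i
  simp only [Finset.mem_filter]
  constructor
  · rintro ⟨h1, h2, rfl⟩
    exact ⟨h1, ⟨h2, he.2⟩, rfl⟩
  · rintro ⟨h1, ⟨h2, -⟩, rfl⟩
    exact ⟨h1, h2, rfl⟩

lemma colourDegree_edgeUse_sub (w : ℕ → V) (S : Finset ℕ) (hS : ∀ i ∈ S, w i ≠ w (i + 1))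
    (x : V) :
    (colourDegree (edgeUse w S) false x : ℤ) - colourDegree (edgeUse w S) true x =
      ∑ i ∈ S, (-1) ^ i * ((if w i = x then 1 else 0) + (if w (i + 1) = x then 1 else 0)) := by
  rw [colourDegree_edgeUse, colourDegree_edgeUse, Finset.card_filter, Finset.card_filter]
  push_cast
  rw [← Finset.sum_sub_distrib]
  refine Finset.sum_congr rfl fun i hi => ?_
  have hne := hS i hi
  have hmem : x ∈ s(w i, w (i + 1)) ↔ w i = x ∨ w (i + 1) = x := by
    rw [Sym2.mem_iff, eq_comm, @eq_comm _ x]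
  simp only [hmem]
  rcases Nat.even_or_odd i with h | h
  · have hb : i.bodd = false := by
      rw [Nat.even_iff, Nat.mod_two_of_bodd] at h
      simpa using h
    by_cases h1 : w i = x <;> by_cases h2 : w (i + 1) = x <;> simp_all
  · have hb : i.bodd = true := by
      rw [Nat.odd_iff, Nat.mod_two_of_bodd] at h
      simpa using h
    by_cases h1 : w i = x <;> by_cases h2 : w (i + 1) = x <;> simp_all

lemma sum_colourDegree (c : Bool → Sym2 V → ℕ) (hloop : ∀ b e, c b e ≠ 0 → ¬ e.IsDiag)
    (b : Bool) : ∑ x, colourDegree c b x = 2 * ∑ e, c b e := by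
  simp only [colourDegree, Finset.sum_filter]
  rw [Finset.sum_comm, Finset.mul_sum]
  refine Finset.sum_congr rfl fun e _ => ?_
  rw [← Finset.sum_filter, Finset.sum_const, smul_eq_mul]
  by_cases h : c b e = 0
  · simp [h]
  · rw [← Sym2.card_toFinset_of_not_isDiag e (hloop b e h)]
    congr 2
    ext x
    simp

/-- An alternating trail in a balanced bicoloured multigraph which does not return to its starting
point after an even number of steps can be extended. -/
lemma exists_trail_extension (c : Bool → Sym2 V → ℕ) (hloop : ∀ b e, c b e ≠ 0 → ¬ e.IsDiag)
    (hbal : ∀ x, colourDegree c false x = colourDegree c true x) {w : ℕ → V} {L : ℕ}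
    (htrail : ∀ b e, edgeUse w (Finset.range L) b e ≤ c b e)
    (hopen : ¬ (L % 2 = 0 ∧ w L = w 0)) :
    ∃ w', ∀ b e, edgeUse w' (Finset.range (L + 1)) b e ≤ c b e := by
  have hadj : ∀ i ∈ Finset.range L, w i ≠ w (i + 1) := by
    intro i hi
    have h1 := edgeUse_ne_zero w hi
    have h2 := htrail i.bodd s(w i, w (i + 1))
    have := hloop i.bodd s(w i, w (i + 1)) (by omega)
    simpa using this
  have hsub := colourDegree_edgeUse_sub w _ hadj (w L)
  rw [Finset.range_eq_Ico, sum_alternating_Ico (fun i => if w i = w L then 1 else 0)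
    (Nat.zero_le L), ← Finset.range_eq_Ico] at hsub
  have hlt : colourDegree (edgeUse w (Finset.range L)) L.bodd (w L) <
      colourDegree c L.bodd (w L) := by
    have hle : ∀ b, colourDegree (edgeUse w (Finset.range L)) b (w L) ≤ colourDegree c b (w L) :=
      fun b => Finset.sum_le_sum fun e _ => htrail b e
    have h1 := hle false
    have h2 := hle true
    have h3 := hbal (w L)
    rcases Nat.even_or_odd L with h | h
    · have hb : L.bodd = false := by
        have := Nat.even_iff.1 h
        rw [Nat.mod_two_of_bodd] at this
        simpa using this
      have hne : w 0 ≠ w L := fun h' => hopen ⟨Nat.even_iff.1 h, h'.symm⟩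
      simp only [hne, h.neg_one_pow, if_false, if_true] at hsub
      rw [hb]
      omega
    · have hb : L.bodd = true := by
        have := Nat.odd_iff.1 h
        rw [Nat.mod_two_of_bodd] at this
        simpa using this
      simp only [h.neg_one_pow, if_true] at hsub
      rw [hb]
      split_ifs at hsub <;> omega
  obtain ⟨e, he, hlt⟩ := Finset.exists_lt_of_sum_lt hlt
  rw [Finset.mem_filter] at he
  obtain ⟨y, rfl⟩ := Sym2.mem_iff_exists.1 he.2
  refine ⟨Function.update w (L + 1) y, fun b e => ?_⟩
  have hupd : ∀ i ≤ L, Function.update w (L + 1) y i = w i := fun i hi =>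
    Function.update_of_ne (by omega) _ _
  have hrest : edgeUse (Function.update w (L + 1) y) (Finset.range L) b e =
      edgeUse w (Finset.range L) b e := by
    unfold edgeUse
    congr 1
    refine Finset.filter_congr fun i hi => ?_
    rw [Finset.mem_range] at hi
    rw [hupd i (by omega), hupd (i + 1) (by omega)]
  unfold edgeUse at hrest ⊢
  rw [Finset.range_add_one, Finset.filter_insert, hupd L le_rfl, Function.update_self]
  split_ifs with h
  · obtain ⟨rfl, rfl⟩ := h
    rw [Finset.card_insert_of_notMem (by simp), hrest]
    exact hlt
  · rw [hrest]
    exact htrail b e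

/-- A nonempty balanced bicoloured multigraph contains a nonempty closed alternating trail. -/
lemma exists_closed_trail (c : Bool → Sym2 V → ℕ) (hloop : ∀ b e, c b e ≠ 0 → ¬ e.IsDiag)
    (hbal : ∀ x, colourDegree c false x = colourDegree c true x) (hne : ∃ e, c false e ≠ 0) :
    ∃ w : ℕ → V, ∃ L, 0 < L ∧ L % 2 = 0 ∧ w L = w 0 ∧
      ∀ b e, edgeUse w (Finset.range L) b e ≤ c b e := by
  by_contra hcon
  have hlong : ∀ L, ∃ w : ℕ → V, ∀ b e, edgeUse w (Finset.range (L + 1)) b e ≤ c b e := by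
    intro L
    induction L with
    | zero =>
      obtain ⟨e, he⟩ := hne
      induction e using Sym2.ind with
      | _ x y =>
      refine ⟨fun i => if i = 0 then x else y, fun b e => ?_⟩
      simp only [edgeUse, zero_add, Finset.range_one, Finset.filter_singleton,
        one_ne_zero, if_true, if_false]
      split_ifs with h
      · obtain ⟨rfl, rfl⟩ := h
        simpa [Nat.one_le_iff_ne_zero] using he
      · simp
    | succ L ih =>
      obtain ⟨w, hw⟩ := ih
      exact exists_trail_extension c hloop hbal hw
        fun h => hcon ⟨w, L + 1, by omega, h.1, h.2, hw⟩
  obtain ⟨w, hw⟩ := hlong (∑ e, c false e + ∑ e, c true e)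
  have h := sum_edgeUse w (Finset.range (∑ e, c false e + ∑ e, c true e + 1))
  have h1 := Finset.sum_le_sum (fun e (_ : e ∈ Finset.univ) => hw false e)
  have h2 := Finset.sum_le_sum (fun e (_ : e ∈ Finset.univ) => hw true e)
  rw [Finset.card_range] at h
  omega

/-- A minimal nonempty balanced bicoloured multigraph on `n ≥ 4` vertices has at most `2 n - 4`
edges. -/
lemma card_edges_add_four_le (hn : 4 ≤ Fintype.card V) (c : Bool → Sym2 V → ℕ)
    (hloop : ∀ b e, c b e ≠ 0 → ¬ e.IsDiag)
    (hbal : ∀ x, colourDegree c false x = colourDegree c true x) (hne : ∃ e, c false e ≠ 0)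
    (hmin : ∀ d : Bool → Sym2 V → ℕ, (∃ b e, d b e ≠ 0) → (∀ b e, d b e ≤ c b e) →
      (∀ x, colourDegree d false x = colourDegree d true x) → d = c) :
    ∑ e, c false e + ∑ e, c true e + 4 ≤ 2 * Fintype.card V := by
  obtain ⟨w, L, hL, heven, hclosed, htrail⟩ := exists_closed_trail c hloop hbal hne
  have hadj : ∀ i < L, w i ≠ w (i + 1) := by
    intro i hi
    have h1 := edgeUse_ne_zero w (Finset.mem_range.2 hi)
    have h2 := htrail i.bodd s(w i, w (i + 1))
    have := hloop i.bodd s(w i, w (i + 1)) (by omega)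
    simpa using this
  have hS : ∀ S ⊆ Finset.range L, S.Nonempty →
      (∀ x, ∑ i ∈ S, (-1 : ℤ) ^ i *
        ((if w i = x then 1 else 0) + (if w (i + 1) = x then 1 else 0)) = 0) →
      S.card = ∑ e, c false e + ∑ e, c true e := by
    rintro S hSL ⟨i, hi⟩ hsum
    rw [← hmin (edgeUse w S) ⟨_, _, edgeUse_ne_zero w hi⟩
      (fun b e => (edgeUse_mono w hSL b e).trans (htrail b e)) ?_, sum_edgeUse]
    intro x
    have := colourDegree_edgeUse_sub w S
      (fun i hi => hadj i (Finset.mem_range.1 (hSL hi))) x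
    rw [hsum] at this
    omega
  have hLsum := hS (Finset.range L) subset_rfl ⟨0, Finset.mem_range.2 hL⟩ (fun x => by
    rw [Finset.range_eq_Ico, sum_alternating_Ico (fun i => if w i = x then 1 else 0)
      (Nat.zero_le L), hclosed, (Nat.even_iff.2 heven).neg_one_pow]
    simp)
  rw [Finset.card_range] at hLsum
  have hpow : ∀ i j, (i + j) % 2 = 1 → (-1 : ℤ) ^ i = - (-1) ^ j := by
    intro i j h
    rcases Nat.even_or_odd i with h' | h' <;> rcases Nat.even_or_odd j with h'' | h'' <;>
      simp [h'.neg_one_pow, h''.neg_one_pow] <;> grind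
  have hpow' : ∀ i j, (i + j) % 2 = 0 → (-1 : ℤ) ^ i = (-1) ^ j := by
    intro i j h
    rcases Nat.even_or_odd i with h' | h' <;> rcases Nat.even_or_odd j with h'' | h'' <;>
      simp [h'.neg_one_pow, h''.neg_one_pow] <;> grind
  have hodd : ∀ i j, i < j → j < L → w i = w j → (i + j) % 2 = 1 := by
    intro i j hij hj hw
    by_contra hcon
    have := hS (Finset.Ico i j)
      (fun k hk => by simp only [Finset.mem_Ico, Finset.mem_range] at hk ⊢; omega)
      ⟨i, by simp [hij]⟩ (fun x => by
        rw [sum_alternating_Ico (fun i => if w i = x then 1 else 0) hij.le, hw,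
          hpow' i j (by omega), sub_self])
    rw [Nat.card_Ico] at this
    omega
  have hcross : ∀ i k j l, i < k → k < j → j < l → l < L → w i = w j → w k ≠ w l := by
    intro i k j l hik hkj hjl hl hij hkl
    have hdisj : Disjoint (Finset.Ico i k) (Finset.Ico j l) := by
      rw [Finset.disjoint_left]
      intro a ha hb
      rw [Finset.mem_Ico] at ha hb
      omega
    have := hS (Finset.Ico i k ∪ Finset.Ico j l)
      (fun a ha => by
        simp only [Finset.mem_union, Finset.mem_Ico, Finset.mem_range] at ha ⊢
        omega)
      ⟨i, by simp [hik]⟩ (fun x => by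
        rw [Finset.sum_union hdisj, sum_alternating_Ico (fun i => if w i = x then 1 else 0) hik.le,
          sum_alternating_Ico (fun i => if w i = x then 1 else 0) hjl.le, hij, hkl,
          hpow i j (hodd i j (by omega) (by omega) hij),
          hpow k l (hodd k l (by omega) (by omega) hkl)]
        ring)
    rw [Finset.card_union_of_disjoint hdisj, Nat.card_Ico, Nat.card_Ico] at this
    omega
  rw [← hLsum]
  rcases Nat.lt_or_ge L 4 with h | h
  · omega
  · refine length_add_four_le_two_mul_card h heven hodd (fun i hi => hadj i (by omega)) ?_ hcross
    have := hadj (L - 1) (by omega)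
    rw [Nat.sub_add_cancel (by omega), hclosed] at this
    exact this.symm

end

section

variable {V : Type}

lemma edgeMonomial_eq_monomial [Fintype V] [DecidableEq V] (K : Type) [CommRing K]
    {e : Sym2 V} (he : ¬ e.IsDiag) :
    edgeMonomial V K e =
      monomial (Finsupp.equivFunOnFinite.symm fun x => if x ∈ e then 1 else 0) 1 := by
  induction e using Sym2.ind with
  | _ i j =>
  have hij : i ≠ j := by simpa using he
  have : (Finsupp.equivFunOnFinite.symm fun x => if x ∈ s(i, j) then 1 else 0) =
      Finsupp.single i 1 + Finsupp.single j 1 := by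
    ext x
    simp only [Finsupp.equivFunOnFinite_symm_apply_apply, Sym2.mem_iff, Finsupp.add_apply,
      Finsupp.single_apply]
    by_cases h1 : x = i <;> by_cases h2 : x = j <;> simp_all [eq_comm]
  rw [this]
  simp [edgeMonomial, X, monomial_mul]

/-- The degree of the vertex `x` in the multigraph with edge multiplicities `u`. -/
def vertexDegree [DecidableEq V] {G : SimpleGraph V} [Fintype G.edgeSet] (u : G.edgeSet → ℕ) (x : V) : ℕ :=
  ∑ e : G.edgeSet, if x ∈ (e : Sym2 V) then u e else 0

lemma vertexDegree_add [DecidableEq V] {G : SimpleGraph V} [Fintype G.edgeSet]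
    (u v : G.edgeSet → ℕ) (x : V) :
    vertexDegree (u + v) x = vertexDegree u x + vertexDegree v x := by
  simp only [vertexDegree, ← Finset.sum_add_distrib, Pi.add_apply]
  exact Finset.sum_congr rfl fun e _ => by split_ifs <;> rfl

lemma colourDegree_eq_vertexDegree [Fintype V] [DecidableEq V] {G : SimpleGraph V}
    [Fintype G.edgeSet] (c : Bool → Sym2 V → ℕ)
    (hc : ∀ b, ∀ e ∉ G.edgeSet, c b e = 0) (b : Bool) (x : V) :
    colourDegree c b x = vertexDegree (G := G) (fun e => c b e) x := by
  rw [colourDegree, Finset.sum_filter]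
  refine (Fintype.sum_of_injective (Subtype.val : G.edgeSet → Sym2 V) Subtype.val_injective _ _
    (fun e he => ?_) (fun _ => rfl)).symm
  rw [hc b e (by simpa using he), ite_self]

/-- Extension by zero of a function on the edges of `G` to all unordered pairs. -/
def extendEdges (G : SimpleGraph V) [DecidableRel G.Adj] (f : G.edgeSet → ℕ) (e : Sym2 V) : ℕ :=
  if h : e ∈ G.edgeSet then f ⟨e, h⟩ else 0

variable {G : SimpleGraph V} [DecidableRel G.Adj]

/-- The bicoloured multigraph with edge multiplicities `u` and `v`. -/
def bicolour (u v : G.edgeSet → ℕ) (b : Bool) : Sym2 V → ℕ :=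
  extendEdges G (cond b v u)

@[simp]
lemma extendEdges_coe (f : G.edgeSet → ℕ) (e : G.edgeSet) : extendEdges G f e = f e := by
  simp [extendEdges]

lemma extendEdges_of_notMem (f : G.edgeSet → ℕ) {e : Sym2 V} (h : e ∉ G.edgeSet) :
    extendEdges G f e = 0 := by
  simp [extendEdges, h]

lemma bicolour_not_isDiag (u v : G.edgeSet → ℕ) (b : Bool) (e : Sym2 V)
    (h : bicolour u v b e ≠ 0) : ¬ e.IsDiag := by
  refine G.not_isDiag_of_mem_edgeSet ?_
  by_contra he
  exact h (extendEdges_of_notMem _ he)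

variable [Fintype V] [Fintype G.edgeSet]

lemma sum_extendEdges (f : G.edgeSet → ℕ) : ∑ e, extendEdges G f e = ∑ e, f e :=
  (Fintype.sum_of_injective (Subtype.val : G.edgeSet → Sym2 V) Subtype.val_injective _ _
    (fun e he => extendEdges_of_notMem f (by simpa using he)) (by simp)).symm

variable [DecidableEq V]

lemma colourDegree_bicolour (u v : G.edgeSet → ℕ) (b : Bool) (x : V) :
    colourDegree (bicolour u v) b x = vertexDegree (cond b v u) x := by
  rw [colourDegree_eq_vertexDegree (G := G) (bicolour u v) fun _ _ h => extendEdges_of_notMem _ h]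
  simp [bicolour]

lemma sum_eq_of_vertexDegree_eq {u v : G.edgeSet → ℕ}
    (h : ∀ x, vertexDegree u x = vertexDegree v x) : ∑ e, u e = ∑ e, v e := by
  have h0 := sum_colourDegree _ (bicolour_not_isDiag u v) false
  have h1 := sum_colourDegree _ (bicolour_not_isDiag u v) true
  simp only [colourDegree_bicolour, cond_true, cond_false, bicolour, sum_extendEdges, h] at h0 h1
  omega

end

lemma binomial_mem_toricIdeal_iff {V : Type} [Fintype V] [DecidableEq V] {G : SimpleGraph V}
    [Fintype G.edgeSet] (K : Type) [Field K] (u v : G.edgeSet → ℕ) :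
    ((∏ e, X e ^ u e) - ∏ e, X e ^ v e : MvPolynomial G.edgeSet K) ∈ toricIdeal V K G ↔
      ∀ x, vertexDegree u x = vertexDegree v x := by
  have himage : ∀ u : G.edgeSet → ℕ, aeval (fun e : G.edgeSet => edgeMonomial V K (e : Sym2 V))
      (∏ e, X e ^ u e : MvPolynomial G.edgeSet K) =
        monomial (Finsupp.equivFunOnFinite.symm (vertexDegree u)) 1 := by
    intro u
    have : ∀ e : G.edgeSet, edgeMonomial V K (e : Sym2 V) ^ u e =
        monomial (u e • Finsupp.equivFunOnFinite.symm
          fun x => if x ∈ (e : Sym2 V) then 1 else 0) 1 := fun e => by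
      rw [edgeMonomial_eq_monomial K (G.not_isDiag_of_mem_edgeSet e.2), monomial_pow, one_pow]
    simp only [map_prod, map_pow, aeval_X, this]
    rw [← monomial_sum_one]
    refine congrArg (fun a => monomial a (1 : K)) ?_
    ext x
    simp [vertexDegree, Finsupp.finsetSum_apply]
  rw [toricIdeal, RingHom.mem_ker, map_sub, sub_eq_zero, himage, himage, (monomial_left_injective (one_ne_zero (α := K))).eq_iff,
    Finsupp.equivFunOnFinite.symm.injective.eq_iff, funext_iff]

lemma eq_and_eq_of_binomial_eq {σ : Type} [Fintype σ] (K : Type) [Field K] {u v w z : σ → ℕ}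
    (hwz : w ≠ z) (hwu : w ≤ u) (hzv : z ≤ v) (huv : u ≠ v) (hsum : ∑ e, u e = ∑ e, v e)
    (h : ((∏ e, X e ^ w e) - ∏ e, X e ^ z e : MvPolynomial σ K) =
      (∏ e, X e ^ u e) - ∏ e, X e ^ v e) : w = u ∧ z = v := by
  classical
  have hmon : ∀ u : σ → ℕ, (∏ e, X e ^ u e : MvPolynomial σ K) =
      monomial (Finsupp.equivFunOnFinite.symm u) 1 := by
    intro u
    rw [monomial_eq, Finsupp.prod_fintype _ _ (fun _ => pow_zero _)]
    simp
  simp only [hmon] at h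
  have hinj := (Finsupp.equivFunOnFinite (α := σ) (M := ℕ)).symm.injective
  by_cases hw : w = u
  · subst hw
    refine ⟨rfl, hinj (monomial_left_injective (one_ne_zero (α := K)) ?_)⟩
    exact sub_right_injective h
  · exfalso
    have hwv : w ≠ v := by
      rintro rfl
      refine hw (funext fun e => ?_)
      exact (Finset.sum_eq_sum_iff_of_le fun e _ => hwu e).1 hsum.symm e (Finset.mem_univ e)
    have := congrArg (coeff (Finsupp.equivFunOnFinite.symm w)) h
    simp only [coeff_sub, coeff_monomial, hinj.eq_iff, hwz.symm, Ne.symm hw, hwv.symm, if_true,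
      if_false, sub_zero] at this
    exact one_ne_zero this

/-- Let `G` be a finite simple graph on `n ≥ 4` vertices and `K` a
field. If `e^u − e^v` (with `u ≠ v`) is a primitive binomial of the toric ideal `I_G`
(i.e. it lies in `I_G` and no other binomial `e^w − e^z` in `I_G` satisfies
`e^w ∣ e^u` and `e^z ∣ e^v`), then its degree is at most `n − 2`: the total degrees
`|u|` and `|v|` are both at most `n − 2`. -/
theorem degree_of_primitive_binomial_le
    (V K : Type) [Fintype V] [DecidableEq V] [Field K]
    (G : SimpleGraph V) [DecidableRel G.Adj]
    (hn : 4 ≤ Fintype.card V)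
    (u v : G.edgeSet → ℕ) (huv : u ≠ v)
    (hmem : ((∏ e, X e ^ u e) - ∏ e, X e ^ v e : MvPolynomial G.edgeSet K)
      ∈ toricIdeal V K G)
    (hprim : ∀ w z : G.edgeSet → ℕ, w ≠ z →
      ((∏ e, X e ^ w e) - ∏ e, X e ^ z e : MvPolynomial G.edgeSet K) ∈ toricIdeal V K G →
      ((∏ e, X e ^ w e : MvPolynomial G.edgeSet K) ∣ ∏ e, X e ^ u e) →
      ((∏ e, X e ^ z e : MvPolynomial G.edgeSet K) ∣ ∏ e, X e ^ v e) →
      ((∏ e, X e ^ w e) - ∏ e, X e ^ z e : MvPolynomial G.edgeSet K)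
        = (∏ e, X e ^ u e) - ∏ e, X e ^ v e) :
    (∑ e, u e) ≤ Fintype.card V - 2 ∧ (∑ e, v e) ≤ Fintype.card V - 2 := by
  have hbal := (binomial_mem_toricIdeal_iff K u v).1 hmem
  have hsum := sum_eq_of_vertexDegree_eq hbal
  have hmin : ∀ w z : G.edgeSet → ℕ, w ≠ z → (∀ x, vertexDegree w x = vertexDegree z x) →
      w ≤ u → z ≤ v → w = u ∧ z = v := by
    intro w z hwz hwzbal hwu hzv
    exact eq_and_eq_of_binomial_eq K hwz hwu hzv huv hsum
      (hprim w z hwz ((binomial_mem_toricIdeal_iff K w z).2 hwzbal)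
        (Finset.prod_dvd_prod_of_dvd _ _ fun e _ => pow_dvd_pow _ (hwu e))
        (Finset.prod_dvd_prod_of_dvd _ _ fun e _ => pow_dvd_pow _ (hzv e)))
  have hdisj : ∀ e, u e ≠ 0 → v e = 0 := by
    intro e hue
    by_contra hve
    have single_le : ∀ f : G.edgeSet → ℕ, f e ≠ 0 → Pi.single e 1 ≤ f := by
      intro f hf a
      by_cases h : a = e
      · subst h
        simpa [Nat.one_le_iff_ne_zero] using hf
      · simp [h]
    have hu := tsub_add_cancel_of_le (single_le u hue)
    have hv := tsub_add_cancel_of_le (single_le v hve)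
    have hwz : u - Pi.single e 1 ≠ v - Pi.single e 1 := fun h => huv (by rw [← hu, h, hv])
    have := (hmin _ _ hwz (fun x => by
      have := hbal x
      rw [← hu, ← hv, vertexDegree_add, vertexDegree_add] at this
      exact Nat.add_right_cancel this) tsub_le_self tsub_le_self).1
    have := congrFun this e
    simp only [Pi.sub_apply, Pi.single_eq_same] at this
    omega
  have hne : ∃ e, bicolour u v false e ≠ 0 := by
    by_contra! hcon
    have hu : ∀ e, u e = 0 := fun e => by simpa [bicolour] using hcon e
    refine huv (funext fun e => ?_)
    simp only [hu, Finset.sum_const_zero] at hsum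
    rw [hu, Finset.sum_eq_zero_iff.1 hsum.symm e (Finset.mem_univ e)]
  have hmain := card_edges_add_four_le hn (bicolour u v) (bicolour_not_isDiag u v)
    (fun x => by simpa [colourDegree_bicolour] using hbal x) hne ?_
  · simp only [bicolour, sum_extendEdges, cond_true, cond_false] at hmain
    omega
  · rintro d ⟨b₀, e₀, hd₀⟩ hle hdbal
    have hout : ∀ b, ∀ e ∉ G.edgeSet, d b e = 0 := fun b e he =>
      Nat.le_zero.1 ((hle b e).trans_eq (extendEdges_of_notMem _ he))
    have hdu : ∀ e : G.edgeSet, d false e ≤ u e := fun e => by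
      simpa [bicolour] using hle false e
    have hdv : ∀ e : G.edgeSet, d true e ≤ v e := fun e => by
      simpa [bicolour] using hle true e
    have hwz : (fun e : G.edgeSet => d false e) ≠ fun e : G.edgeSet => d true e := by
      intro h
      have he₀ : e₀ ∈ G.edgeSet := by
        by_contra he
        exact hd₀ (hout _ _ he)
      have h1 := congrFun h ⟨e₀, he₀⟩
      have h2 := hdu ⟨e₀, he₀⟩
      have h3 := hdv ⟨e₀, he₀⟩
      have h4 := hdisj ⟨e₀, he₀⟩
      dsimp only at h1 h2 h3
      cases b₀ <;> omega
    obtain ⟨h1, h2⟩ := hmin _ _ hwz (fun x => by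
      simpa only [colourDegree_eq_vertexDegree (G := G) d hout] using hdbal x) hdu hdv
    funext b e
    by_cases he : e ∈ G.edgeSet
    · cases b
      · simpa [bicolour, extendEdges, he] using congrFun h1 ⟨e, he⟩
      · simpa [bicolour, extendEdges, he] using congrFun h2 ⟨e, he⟩
    · rw [hout b e he, bicolour, extendEdges_of_notMem _ he]
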